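/- Let m ≥ 5 be odd and let u be a positive integer with gcd(u, m) = 1. Suppose either (m² − 1)/8 is even and ρ = 1, or (m² − 1)/8 is odd and ρ = 0. Then C_{D_ρ} is a binary projective three-weight linear code of length 2^{m−2} + 2^{(m−3)/2}, dimension m and minimum distance 2^{m−3}, and its weight distribution is: A_{2^{m−3}} = 2^{m−1} − 1, A_{2^{m−3}+2^{(m−3)/2}} = 2^{m−1} − 1, A_{2^{m−2}+2^{(m−3)/2}} = 1, and A_i = 0 for all other i ≥ 1. -/

import Mathlib

/-- Hamming weight of a binary vector: the number of nonzero coordinates. -/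
noncomputable def wt {ι : Type*} (c : ι → ZMod 2) : ℕ := Nat.card {i : ι // c i ≠ 0}

/-- Number of codewords of Hamming weight `w` in a set of binary vectors. -/
noncomputable def weightCount {ι : Type*} (C : Set (ι → ZMod 2)) (w : ℕ) : ℕ :=
  Nat.card {c : ι → ZMod 2 // c ∈ C ∧ wt c = w}

/-- The dual code: all vectors orthogonal (standard inner product) to every codeword. -/
def dualCode {ι : Type*} (C : Set (ι → ZMod 2)) : Set (ι → ZMod 2) :=
  {x | ∀ c ∈ C, ∑ᶠ i, x i * c i = 0}

/-- A code is projective if the minimum distance of its dual is at least 3. -/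
def IsProjective {ι : Type*} (C : Set (ι → ZMod 2)) : Prop :=
  ∀ x ∈ dualCode C, x ≠ 0 → 3 ≤ wt x

/-- `d` is the minimum distance of `C`: the least Hamming weight of a nonzero codeword. -/
def IsMinDist {ι : Type*} (C : Set (ι → ZMod 2)) (d : ℕ) : Prop :=
  (∃ c ∈ C, c ≠ 0 ∧ wt c = d) ∧ ∀ c ∈ C, c ≠ 0 → d ≤ wt c

/-- The number of nonzero Hamming weights occurring among codewords of `C`. -/
noncomputable def numNonzeroWeights {ι : Type*} (C : Set (ι → ZMod 2)) : ℕ :=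
  Nat.card {i : ℕ | 1 ≤ i ∧ weightCount C i ≠ 0}

/-- The codewords of weight `w` in `C` hold a 2-design with index `lam`: every pair of
distinct coordinate positions lies in the support of exactly `lam` codewords of weight `w`. -/
def HoldsTwoDesign {ι : Type*} (C : Set (ι → ZMod 2)) (w lam : ℕ) : Prop :=
  ∀ p q : ι, p ≠ q →
    Nat.card {c : ι → ZMod 2 // c ∈ C ∧ wt c = w ∧ c p ≠ 0 ∧ c q ≠ 0} = lam

/-- The defining set `D_ρ = {x ∈ F_{2^m} : Tr(x) = 1, Tr(x^{2^u+1}) = ρ}`. -/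
def Dset (m u : ℕ) (ρ : ZMod 2) : Set (GaloisField 2 m) :=
  {x | Algebra.trace (ZMod 2) (GaloisField 2 m) x = 1 ∧
       Algebra.trace (ZMod 2) (GaloisField 2 m) (x ^ (2 ^ u + 1)) = ρ}

/-- The linear map `b ↦ (Tr(b·d))_{d ∈ D_ρ}`. -/
noncomputable def codeMap (m u : ℕ) (ρ : ZMod 2) :
    GaloisField 2 m →ₗ[ZMod 2] (↥(Dset m u ρ) → ZMod 2) :=
  LinearMap.pi fun d =>
    (Algebra.trace (ZMod 2) (GaloisField 2 m)).comp
      (LinearMap.mulRight (ZMod 2) (d : GaloisField 2 m))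

/-- The code `C_{D_ρ} = {(Tr(b·d))_{d ∈ D_ρ} : b ∈ F_{2^m}}`. -/
noncomputable def codeD (m u : ℕ) (ρ : ZMod 2) :
    Submodule (ZMod 2) (↥(Dset m u ρ) → ZMod 2) :=
  LinearMap.range (codeMap m u ρ)


set_option linter.unusedSectionVars false

/-- The nontrivial sign character of `ZMod 2`. -/
def sg (a : ZMod 2) : ℤ := if a = 0 then 1 else -1

lemma sg_add (a b : ZMod 2) : sg (a + b) = sg a * sg b := by
  revert a b; decide

lemma sg_zero : sg 0 = 1 := by decide
lemma sg_one : sg 1 = -1 := by decide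

lemma zmod2_cases (a : ZMod 2) : a = 0 ∨ a = 1 := by revert a; decide

section charsum
variable {K : Type*} [Field K] [Fintype K] [DecidableEq K] [Algebra (ZMod 2) K]

/-- Shorthand for the absolute trace. -/
noncomputable def tr (K : Type*) [Field K] [Algebra (ZMod 2) K] : K →ₗ[ZMod 2] ZMod 2 :=
  Algebra.trace (ZMod 2) K

lemma exists_tr_one (a : K) (ha : a ≠ 0) : ∃ y, tr K (a * y) = 1 := by
  by_contra h
  push Not at h
  apply ha
  have := traceForm_nondegenerate (ZMod 2) K
  apply this.1 a
  intro y
  rw [Algebra.traceForm_apply]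
  exact (zmod2_cases _).resolve_right (h y)

lemma sum_sg (a : K) : ∑ x : K, sg (tr K (a * x)) = if a = 0 then (Fintype.card K : ℤ) else 0 := by
  split_ifs with h
  · subst h; simp [sg_zero]
  · obtain ⟨y, hy⟩ := exists_tr_one a h
    have h1 : ∑ x : K, sg (tr K (a * x)) = ∑ x : K, sg (tr K (a * (x + y))) :=
      (Equiv.sum_comp (Equiv.addRight y) (fun x => sg (tr K (a * x)))).symm
    have h2 : ∑ x : K, sg (tr K (a * (x + y))) = - ∑ x : K, sg (tr K (a * x)) := by
      rw [← Finset.sum_neg_distrib]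
      refine Finset.sum_congr rfl fun x _ => ?_
      rw [mul_add, map_add, sg_add, hy, sg_one]; ring
    linarith

lemma tr_pow (x : K) (n : ℕ) : tr K (x ^ 2 ^ n) = tr K x := by
  induction n with
  | zero => simp
  | succ n ih =>
    rw [pow_succ, pow_mul, ← ih]
    have := Algebra.trace_eq_of_algEquiv (FiniteField.frobeniusAlgEquivOfAlgebraic (ZMod 2) K)
      (x ^ 2 ^ n)
    simpa [FiniteField.coe_frobeniusAlgEquivOfAlgebraic, tr] using this

lemma fixed_cases (m u : ℕ) (hcard : Fintype.card K = 2 ^ m) (hmodd : Odd m)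
    (hgcd : Nat.gcd u m = 1) (z : K) (hz : z ^ 2 ^ (2 * u) = z) : z = 0 ∨ z = 1 := by
  have h1 : Function.IsPeriodicPt (fun y : K => y ^ 2) (2 * u) z := by
    rw [Function.IsPeriodicPt, Function.IsFixedPt, pow_iterate]; exact hz
  have h2 : Function.IsPeriodicPt (fun y : K => y ^ 2) m z := by
    rw [Function.IsPeriodicPt, Function.IsFixedPt, pow_iterate]
    rw [← hcard]; exact FiniteField.pow_card z
  have h3 := h1.gcd h2
  have h4 : Nat.gcd (2 * u) m = 1 := by
    apply Nat.Coprime.mul_left _ hgcd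
    exact (Nat.coprime_two_left).2 hmodd
  rw [h4, Function.IsPeriodicPt, Function.IsFixedPt, pow_iterate] at h3
  have h5 : z * (z - 1) = 0 := by
    have : z ^ 2 = z := by simpa using h3
    linear_combination this
  rcases mul_eq_zero.1 h5 with h | h
  · exact Or.inl h
  · exact Or.inr (sub_eq_zero.1 h)

/-- Walsh transform of the Gold function. -/
noncomputable def Ws (K : Type*) [Field K] [Fintype K] [Algebra (ZMod 2) K] (u : ℕ) (b : K) : ℤ :=
  ∑ x : K, sg (tr K (x ^ (2 ^ u + 1) + b * x))

lemma tr_one (m : ℕ) (hcard : Fintype.card K = 2 ^ m) (hmodd : Odd m) : tr K (1 : K) = 1 := by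
  have h : Module.finrank (ZMod 2) K = m := by
    have := Module.card_eq_pow_finrank (K := ZMod 2) (V := K)
    rw [hcard, ZMod.card] at this
    exact (Nat.pow_right_injective le_rfl this).symm
  have := Algebra.trace_algebraMap (R := ZMod 2) (S := K) (1 : ZMod 2)
  rw [map_one, h] at this
  rw [tr, this, nsmul_eq_mul, mul_one]
  exact (ZMod.natCast_eq_one_iff_odd).2 hmodd

lemma Ws_sq (m u : ℕ) (hcard : Fintype.card K = 2 ^ m) (hmodd : Odd m)
    (hgcd : Nat.gcd u m = 1) (b : K) :
    Ws K u b ^ 2 = if tr K b = 1 then 2 ^ (m + 1) else 0 := by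
  have : CharP K 2 := charP_of_injective_algebraMap (algebraMap (ZMod 2) K).injective 2
  have key : ∀ x z : K, sg (tr K (x ^ (2 ^ u + 1) + b * x)) *
      sg (tr K ((x + z) ^ (2 ^ u + 1) + b * (x + z))) =
      sg (tr K (z ^ (2 ^ u + 1) + b * z)) * sg (tr K ((z + z ^ 2 ^ (2 * u)) * x ^ 2 ^ u)) := by
    intro x z
    rw [← sg_add, ← sg_add, ← map_add, ← map_add]
    congr 1
    have e1 : (x + z) ^ (2 ^ u + 1) = (x ^ 2 ^ u + z ^ 2 ^ u) * (x + z) := by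
      rw [pow_succ, add_pow_char_pow]
    have e2 : tr K (z ^ 2 ^ (2 * u) * x ^ 2 ^ u) = tr K (z ^ 2 ^ u * x) := by
      rw [← tr_pow (z ^ 2 ^ u * x) u, mul_pow, ← pow_mul, two_mul, pow_add]
    have e3 : x ^ (2 ^ u + 1) + b * x + ((x + z) ^ (2 ^ u + 1) + b * (x + z)) =
      z ^ (2 ^ u + 1) + b * z + z * x ^ 2 ^ u + z ^ 2 ^ u * x := by
      rw [e1, pow_succ, pow_succ]
      have : (2 : K) = 0 := CharTwo.two_eq_zero
      linear_combination (x ^ 2 ^ u * x + b * x) * this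
    rw [e3, add_mul]
    simp only [map_add, e2]
    ring
  have hbij : Function.Bijective (fun x : K => x ^ 2 ^ u) := by
    rw [← Finite.injective_iff_bijective]
    intro x y hxy
    have : (frobenius K 2)^[u] x = (frobenius K 2)^[u] y := by
      rw [iterate_frobenius, iterate_frobenius]; exact hxy
    exact (frobenius_inj K 2).iterate u this
  have hsum : Ws K u b ^ 2 = ∑ z : K, sg (tr K (z ^ (2 ^ u + 1) + b * z)) *
      (if z + z ^ 2 ^ (2 * u) = 0 then (Fintype.card K : ℤ) else 0) := by
    rw [sq, Ws, Finset.sum_mul_sum]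
    have : ∀ x : K, ∑ y : K, sg (tr K (x ^ (2 ^ u + 1) + b * x)) *
        sg (tr K (y ^ (2 ^ u + 1) + b * y)) = ∑ z : K, sg (tr K (z ^ (2 ^ u + 1) + b * z)) *
          sg (tr K ((z + z ^ 2 ^ (2 * u)) * x ^ 2 ^ u)) := by
      intro x
      rw [← Equiv.sum_comp (Equiv.addLeft x)]
      exact Finset.sum_congr rfl fun z _ => key x z
    rw [Finset.sum_congr rfl fun x _ => this x, Finset.sum_comm]
    refine Finset.sum_congr rfl fun z _ => ?_
    rw [← Finset.mul_sum, ← sum_sg]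
    congr 1
    exact hbij.sum_comp (fun y => sg (tr K ((z + z ^ 2 ^ (2 * u)) * y)))
  have hne : (0 : K) ≠ 1 := zero_ne_one
  have hterm : ∀ z : K, z ∉ ({0, 1} : Finset K) → sg (tr K (z ^ (2 ^ u + 1) + b * z)) *
      (if z + z ^ 2 ^ (2 * u) = 0 then (Fintype.card K : ℤ) else 0) = 0 := by
    intro z hz
    rw [if_neg, mul_zero]
    intro h
    apply hz
    have := fixed_cases m u hcard hmodd hgcd z (CharTwo.add_eq_zero.1 h).symm
    simpa using this
  rw [hsum, ← Finset.sum_subset (Finset.subset_univ {0, 1}) (fun z _ hz => hterm z hz),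
    Finset.sum_pair hne]
  have h11 : (1 : K) + 1 = 0 := CharTwo.add_self_eq_zero 1
  have ht := tr_one m hcard hmodd
  simp only [one_pow, mul_one, h11, map_add, ht, sg_add, sg_one, if_true, hcard]
  rcases zmod2_cases (tr K b) with h | h
  · simp [h, sg_zero]
  · simp [h, sg_zero, sg_one]; ring

end charsum

section transfer
open MulAction

lemma Ws_eq_card (K : Type*) [Field K] [Fintype K] [Algebra (ZMod 2) K] (u : ℕ) (b : K) :
    Ws K u b = 2 * (Nat.card {x : K // tr K (x ^ (2 ^ u + 1) + b * x) = 0} : ℤ)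
      - Fintype.card K := by
  classical
  have h : ∀ a : ZMod 2, sg a = 2 * (if a = 0 then 1 else 0) - 1 := by decide
  rw [Ws, Finset.sum_congr rfl fun x _ => h _, Finset.sum_sub_distrib, ← Finset.mul_sum,
    Finset.sum_boole, Nat.card_eq_fintype_card, Fintype.card_subtype]
  simp

variable (L M : Type*) [Field L] [Field M] [Fintype L] [Fintype M] [Algebra (ZMod 2) L]
  [Algebra (ZMod 2) M] [Algebra L M] [IsScalarTower (ZMod 2) L M]

lemma tr_algebraMap (hodd : Odd (Module.finrank L M)) (y : L) :
    tr M (algebraMap L M y) = tr L y := by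
  rw [tr, ← Algebra.trace_trace (S := L), Algebra.trace_algebraMap, map_nsmul, nsmul_eq_mul,
    (ZMod.natCast_eq_one_iff_odd).2 hodd, one_mul, tr]

/-- The zero set of the Gold exponential sum phase, as a Galois-stable set. -/
noncomputable def zset (u : ℕ) : SubMulAction Gal(M/L) M where
  carrier := {x | tr M (x ^ (2 ^ u + 1) + 1 * x) = 0}
  smul_mem' g x hx := by
    have := Algebra.trace_eq_of_algEquiv (AlgEquiv.restrictScalars (ZMod 2) g)
      (x ^ (2 ^ u + 1) + 1 * x)
    simp only [Set.mem_ofPred_eq] at hx ⊢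
    rw [← hx, tr, ← this]
    simp

lemma Ws_transfer (p : ℕ) [hp : Fact p.Prime] (hodd : Odd p) (hrank : Module.finrank L M = p)
    (u : ℕ) : ((Ws M u 1 : ℤ) : ZMod p) = ((Ws L u 1 : ℤ) : ZMod p) := by
  have : IsGalois L M := inferInstance
  have hG : IsPGroup p Gal(M/L) := by
    apply IsPGroup.of_card (n := 1)
    rw [IsGalois.card_aut_eq_finrank, hrank, pow_one]
  have h1 := hG.card_modEq_card_fixedPoints (zset L M u)
  have e : Nat.card {x : L // tr L (x ^ (2 ^ u + 1) + 1 * x) = 0} =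
      Nat.card (fixedPoints Gal(M/L) (zset L M u)) := by
    have hmem : ∀ x : L, tr L (x ^ (2 ^ u + 1) + 1 * x) = 0 ↔ algebraMap L M x ∈ zset L M u := by
      intro x
      have : algebraMap L M x ∈ zset L M u ↔
        tr M ((algebraMap L M x) ^ (2 ^ u + 1) + 1 * (algebraMap L M x)) = 0 := Iff.rfl
      rw [this, ← tr_algebraMap L M (hrank ▸ hodd)]
      simp
    refine Nat.card_congr (Equiv.ofBijective
      (fun x => ⟨⟨algebraMap L M x.1, (hmem x.1).1 x.2⟩, ?_⟩) ⟨?_, ?_⟩)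
    · intro g
      ext
      simp
    · intro x y hxy
      ext
      have := congrArg (fun z => ((z : zset L M u) : M)) (congrArg Subtype.val hxy)
      exact (algebraMap L M).injective this
    · rintro ⟨⟨y, hy⟩, hfix⟩
      have : y ∈ Set.range (algebraMap L M) := by
        rw [IsGalois.mem_range_algebraMap_iff_fixed]
        intro g
        have := congrArg (fun z => ((z : zset L M u) : M)) (hfix g)
        simpa using this
      obtain ⟨x, rfl⟩ := this
      exact ⟨⟨x, (hmem x).2 hy⟩, rfl⟩
  rw [← e] at h1
  have e2 : Nat.card (zset L M u) = Nat.card {x : M // tr M (x ^ (2 ^ u + 1) + 1 * x) = 0} := rfl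
  rw [e2, ← ZMod.natCast_eq_natCast_iff] at h1
  have hc : Fintype.card M = Fintype.card L ^ p := by
    rw [← hrank]; exact Module.card_eq_pow_finrank
  rw [Ws_eq_card, Ws_eq_card]
  push_cast
  rw [h1, hc]
  push_cast
  rw [ZMod.pow_card]

end transfer

noncomputable instance instFintypeGF (m : ℕ) : Fintype (GaloisField 2 m) := Fintype.ofFinite _

lemma card_GF (m : ℕ) (hm : m ≠ 0) : Fintype.card (GaloisField 2 m) = 2 ^ m := by
  rw [← Nat.card_eq_fintype_card, GaloisField.card 2 m hm]

lemma Ws_step (k p u : ℕ) (hk : k ≠ 0) [hp : Fact p.Prime] (hodd : Odd p) :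
    ((Ws (GaloisField 2 (p * k)) u 1 : ℤ) : ZMod p) = ((Ws (GaloisField 2 k) u 1 : ℤ) : ZMod p) := by
  have hpk : p * k ≠ 0 := mul_ne_zero hp.out.ne_zero hk
  have hne : Nonempty (GaloisField 2 k →ₐ[ZMod 2] GaloisField 2 (p * k)) := by
    apply FiniteField.nonempty_algHom_of_finrank_dvd
    rw [GaloisField.finrank 2 hk, GaloisField.finrank 2 hpk]
    exact dvd_mul_left _ _
  obtain ⟨f⟩ := hne
  let _ : Algebra (GaloisField 2 k) (GaloisField 2 (p * k)) := f.toRingHom.toAlgebra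
  have : IsScalarTower (ZMod 2) (GaloisField 2 k) (GaloisField 2 (p * k)) :=
    IsScalarTower.of_algebraMap_eq fun x => (f.commutes x).symm
  apply Ws_transfer _ _ p hodd
  have := Module.finrank_mul_finrank (ZMod 2) (GaloisField 2 k) (GaloisField 2 (p * k))
  rw [GaloisField.finrank 2 hk, GaloisField.finrank 2 hpk, mul_comm] at this
  exact Nat.eq_of_mul_eq_mul_right (Nat.pos_of_ne_zero hk) this

lemma Ws_abs (m u : ℕ) (hmodd : Odd m) (hgcd : Nat.gcd u m = 1) (b : GaloisField 2 m)
    (hb : tr _ b = 1) :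
    ∃ e : ℤ, (e = 1 ∨ e = -1) ∧ Ws (GaloisField 2 m) u b = e * 2 ^ ((m + 1) / 2) := by
  classical
  have h := Ws_sq m u (card_GF m hmodd.pos.ne') hmodd hgcd b
  rw [if_pos hb] at h
  obtain ⟨r, hr⟩ := hmodd
  have h2 : (m + 1) / 2 = r + 1 := by omega
  have h3 : m + 1 = (r + 1) * 2 := by omega
  rw [h3, pow_mul] at h
  rcases sq_eq_sq_iff_eq_or_eq_neg.1 h with h | h
  · exact ⟨1, Or.inl rfl, by rw [h, h2]; ring⟩
  · exact ⟨-1, Or.inr rfl, by rw [h, h2]; ring⟩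

lemma Ws_zero (m u : ℕ) (hmodd : Odd m) (hgcd : Nat.gcd u m = 1) (b : GaloisField 2 m)
    (hb : tr _ b = 0) : Ws (GaloisField 2 m) u b = 0 := by
  classical
  have h := Ws_sq m u (card_GF m hmodd.pos.ne') hmodd hgcd b
  rw [if_neg (by rw [hb]; decide)] at h
  exact pow_eq_zero_iff (two_ne_zero) |>.1 h

lemma pm_eq_of_cast (p : ℕ) (hp : 2 < p) (a b : ℤ) (ha : a = 1 ∨ a = -1) (hb : b = 1 ∨ b = -1)
    (h : (a : ZMod p) = (b : ZMod p)) : a = b := by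
  have : Fact (2 < p) := ⟨hp⟩
  have hne : (-1 : ZMod p) ≠ 1 := ZMod.neg_one_ne_one
  rcases ha with rfl | rfl <;> rcases hb with rfl | rfl <;> push_cast at h
  · rfl
  · exact absurd h.symm hne
  · exact absurd h hne
  · rfl

open NumberTheorySymbols in
lemma Ws_one (u : ℕ) : ∀ m : ℕ, Odd m → Nat.gcd u m = 1 →
    Ws (GaloisField 2 m) u 1 = J(2 | m) * 2 ^ ((m + 1) / 2) := by
  classical
  intro m
  induction m using induction_on_primes with
  | zero => intro h; simp at h
  | one =>
    intro _ _
    have h : ∀ x : GaloisField 2 1, x ^ 2 = x := by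
      intro x
      have := FiniteField.pow_card x
      rwa [card_GF 1 one_ne_zero, pow_one] at this
    have h' : ∀ n, ∀ x : GaloisField 2 1, x ^ 2 ^ n = x := by
      intro n x
      induction n with
      | zero => simp
      | succ n ih => rw [pow_succ, pow_mul, ih, h]
    have h2 : ∀ x : GaloisField 2 1, x ^ (2 ^ u + 1) + 1 * x = 0 := by
      intro x
      rw [pow_succ, h', ← sq, h, one_mul, CharTwo.add_self_eq_zero]
    rw [Ws, Finset.sum_congr rfl fun x _ => by rw [h2 x, map_zero, sg_zero]]
    simp [card_GF 1 one_ne_zero]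
  | prime_mul p k hp ih =>
    intro hodd hgcd
    have hpo : Odd p := (Nat.odd_mul.1 hodd).1
    have hko : Odd k := (Nat.odd_mul.1 hodd).2
    have hk0 : k ≠ 0 := hko.pos.ne'
    have : Fact p.Prime := ⟨hp⟩
    have : NeZero k := ⟨hk0⟩
    have hp2 : 2 < p := lt_of_le_of_ne hp.two_le (by rintro rfl; exact absurd hpo (by decide))
    have hgk : Nat.gcd u k = 1 := Nat.Coprime.coprime_dvd_right (dvd_mul_left k p) hgcd
    have hstep := Ws_step k p u hk0 hpo
    have ht : tr (GaloisField 2 (p * k)) 1 = 1 := tr_one (p * k) (card_GF _ hodd.pos.ne') hodd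
    obtain ⟨e, he, hW⟩ := Ws_abs (p * k) u hodd hgcd 1 ht
    rw [hW, ih hko hgk] at hstep
    rw [hW, jacobiSym.mul_right, ← jacobiSym.legendreSym.to_jacobiSym]
    congr 1
    have h20 : (2 : ZMod p) ≠ 0 := by
      intro h
      have : ((2 : ℕ) : ZMod p) = 0 := by exact_mod_cast h
      rw [ZMod.natCast_eq_zero_iff] at this
      exact absurd (Nat.le_of_dvd two_pos this) (by omega)
    have hl : legendreSym p 2 = 1 ∨ legendreSym p 2 = -1 :=
      legendreSym.eq_one_or_neg_one p (by exact_mod_cast h20)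
    have hJ : J(2 | k) = 1 ∨ J(2 | k) = -1 :=
      jacobiSym.eq_one_or_neg_one (by
        rw [Int.gcd_eq_natAbs]; exact (Nat.coprime_two_left).2 hko)
    have hpow := legendreSym.eq_pow p 2
    have hexp : (p * k + 1) / 2 = (p / 2) * k + (k + 1) / 2 := by
      obtain ⟨a, rfl⟩ := hpo
      obtain ⟨c, rfl⟩ := hko
      have h1 : (2 * a + 1) / 2 = a := by omega
      have h2 : (2 * c + 1 + 1) / 2 = c + 1 := by omega
      rw [h1, h2]
      have : (2 * a + 1) * (2 * c + 1) + 1 = 2 * (a * (2 * c + 1) + (c + 1)) := by ring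
      rw [this]; omega
    have hlk : (legendreSym p 2) ^ k = legendreSym p 2 := by
      rcases hl with h | h <;> rw [h]
      · simp
      · exact hko.neg_one_pow
    have hs2 : ((e * legendreSym p 2 : ℤ) : ZMod p) = ((J(2 | k) : ℤ) : ZMod p) := by
      rw [← hlk]
      push_cast at hstep ⊢
      rw [hpow]
      rw [hexp, pow_add, pow_mul] at hstep
      apply mul_right_cancel₀ (pow_ne_zero ((k + 1) / 2) h20)
      push_cast
      linear_combination hstep
    have hfin := pm_eq_of_cast p hp2 _ _ (by
      rcases he with h | h <;> rcases hl with h' | h' <;> simp [h, h']) hJ hs2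
    rw [← hfin]
    rcases hl with h' | h' <;> simp [h']

open NumberTheorySymbols in
lemma sg_rho (m : ℕ) (hmodd : Odd m) (ρ : ZMod 2)
    (hρ : (Even ((m ^ 2 - 1) / 8) ∧ ρ = 1) ∨ (Odd ((m ^ 2 - 1) / 8) ∧ ρ = 0)) :
    sg ρ * J(2 | m) = -1 := by
  rw [jacobiSym.at_two hmodd, ZMod.χ₈_nat_eq_if_mod_eight]
  have h2 : ¬ m % 2 = 0 := by have := Nat.odd_iff.1 hmodd; omega
  rw [if_neg h2]
  have key : ∀ q s c : ℕ, m = 8 * q + s → s ^ 2 = 8 * c + 1 →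
      (m ^ 2 - 1) / 8 = 2 * (4 * q ^ 2 + q * s) + c := by
    intro q s c h1 h2
    have : m ^ 2 = 8 * (2 * (4 * q ^ 2 + q * s) + c) + 1 := by
      rw [h1]; linear_combination h2
    omega
  have hs : m % 8 = 1 ∨ m % 8 = 3 ∨ m % 8 = 5 ∨ m % 8 = 7 := by omega
  have hm := (Nat.div_add_mod m 8).symm
  rw [Nat.even_iff, Nat.odd_iff] at hρ
  rcases hs with h | h | h | h <;> rw [h] at hm ⊢
  · have := key _ _ 0 hm (by norm_num)
    have : ρ = 1 := by
      rcases hρ with ⟨h, h'⟩ | ⟨h, h'⟩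
      · exact h'
      · omega
    simp [this, sg_one]
  · have := key _ _ 1 hm (by norm_num)
    have : ρ = 0 := by
      rcases hρ with ⟨h, h'⟩ | ⟨h, h'⟩
      · omega
      · exact h'
    simp [this, sg_zero]
  · have := key _ _ 3 hm (by norm_num)
    have : ρ = 0 := by
      rcases hρ with ⟨h, h'⟩ | ⟨h, h'⟩
      · omega
      · exact h'
    simp [this, sg_zero]
  · have := key _ _ 6 hm (by norm_num)
    have : ρ = 1 := by
      rcases hρ with ⟨h, h'⟩ | ⟨h, h'⟩
      · exact h'
      · omega
    simp [this, sg_one]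

section final
variable (m u : ℕ) (ρ : ZMod 2)

lemma codeMap_apply (b : GaloisField 2 m) (d : Dset m u ρ) :
    codeMap m u ρ b d = tr _ (b * d.1) := rfl

/-- Character sum over the defining set. -/
noncomputable def Ts (b : GaloisField 2 m) : ℤ :=
  ∑ᶠ d : Dset m u ρ, sg (tr _ (b * d.1))

lemma Ts_eq_wt (b : GaloisField 2 m) :
    Ts m u ρ b = (Nat.card (Dset m u ρ) : ℤ) - 2 * wt (codeMap m u ρ b) := by
  classical
  have : Fintype (Dset m u ρ) := Fintype.ofFinite _
  have h : ∀ a : ZMod 2, sg a = 1 - 2 * (if a ≠ 0 then 1 else 0) := by decide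
  rw [Ts, finsum_eq_sum_of_fintype, Finset.sum_congr rfl fun x _ => h _, Finset.sum_sub_distrib,
    ← Finset.mul_sum, Finset.sum_boole, Finset.sum_const, Finset.card_univ, nsmul_eq_mul, mul_one]
  have hw : wt (codeMap m u ρ b) =
      (Finset.univ.filter fun d : Dset m u ρ => tr _ (b * d.1) ≠ 0).card := by
    rw [← Fintype.card_subtype, ← Nat.card_eq_fintype_card]
    rfl
  rw [hw, Nat.card_eq_fintype_card]

lemma Ts_formula [DecidableEq (GaloisField 2 m)] (hm : m ≠ 0) (b : GaloisField 2 m) :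
    4 * Ts m u ρ b = (if b = 0 then 2 ^ m else 0) - (if b = 1 then 2 ^ m else 0)
      + sg ρ * (Ws _ u b - Ws _ u (b + 1)) := by
  classical
  have hT : Ts m u ρ b = ∑ x : GaloisField 2 m,
      if x ∈ Dset m u ρ then sg (tr _ (b * x)) else 0 := by
    rw [Ts, finsum_eq_sum_of_fintype, ← Finset.sum_filter]
    symm
    apply Finset.sum_subtype
    simp
  have hpt : ∀ x : GaloisField 2 m, 4 * (if x ∈ Dset m u ρ then sg (tr _ (b * x)) else 0) =
      sg (tr _ (b * x)) - sg (tr _ ((b + 1) * x)) + sg ρ * (sg (tr _ (x ^ (2 ^ u + 1) + b * x))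
        - sg (tr _ (x ^ (2 ^ u + 1) + (b + 1) * x))) := by
    intro x
    have hmem : x ∈ Dset m u ρ ↔ tr _ x = 1 ∧ tr _ (x ^ (2 ^ u + 1)) = ρ := Iff.rfl
    rw [if_congr hmem rfl rfl]
    simp only [add_mul, one_mul, map_add]
    generalize tr _ x = a
    generalize tr _ (x ^ (2 ^ u + 1)) = c
    generalize tr _ (b * x) = d
    clear hmem hT
    revert a c d ρ
    decide
  have hb : b + 1 = 0 ↔ b = 1 := CharTwo.add_eq_zero
  rw [hT, Finset.mul_sum, Finset.sum_congr rfl fun x _ => hpt x, Finset.sum_add_distrib,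
    Finset.sum_sub_distrib, ← Finset.mul_sum, Finset.sum_sub_distrib, sum_sg, sum_sg,
    card_GF m hm, if_congr hb rfl rfl, Ws, Ws]
  push_cast
  rfl

lemma Ts_zero : Ts m u ρ 0 = Nat.card (Dset m u ρ) := by
  rw [Ts_eq_wt]
  simp [wt]

lemma Ts_add_one (hm : m ≠ 0) (b : GaloisField 2 m) : Ts m u ρ (b + 1) = - Ts m u ρ b := by
  classical
  have h1 := Ts_formula m u ρ hm b
  have h2 := Ts_formula m u ρ hm (b + 1)
  have e : b + 1 + 1 = b := by rw [add_assoc, CharTwo.add_self_eq_zero, add_zero]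
  have e1 : b + 1 = 0 ↔ b = 1 := CharTwo.add_eq_zero
  have e2 : b + 1 = 1 ↔ b = 0 := by simp
  rw [e, if_congr e1 rfl rfl, if_congr e2 rfl rfl] at h2
  linarith

/-- The projectivity statement: coordinates are pairwise distinct nonzero functionals. -/
lemma codeD_projective : IsProjective (codeD m u ρ : Set (↥(Dset m u ρ) → ZMod 2)) := by
  classical
  intro x hx hx0
  have : Fintype (Dset m u ρ) := Fintype.ofFinite _
  have hx' : ∀ b : GaloisField 2 m, ∑ d : Dset m u ρ, x d * tr _ (b * d.1) = 0 := by
    intro b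
    have := hx (codeMap m u ρ b) ⟨b, rfl⟩
    rw [finsum_eq_sum_of_fintype] at this
    exact this
  set S : Finset (Dset m u ρ) := Finset.univ.filter fun d => x d ≠ 0 with hS
  have hwt : wt x = S.card := by
    rw [wt, Nat.card_eq_fintype_card, Fintype.card_subtype]
  have hS1 : ∀ b : GaloisField 2 m, tr _ (b * ∑ d ∈ S, d.1) = 0 := by
    intro b
    rw [Finset.mul_sum, map_sum, ← hx' b, hS, Finset.sum_filter]
    refine Finset.sum_congr rfl fun d _ => ?_
    rcases zmod2_cases (x d) with h | h <;> simp [h]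
  have hS2 : ∑ d ∈ S, (d.1 : GaloisField 2 m) = 0 := by
    by_contra h
    obtain ⟨y, hy⟩ := exists_tr_one _ h
    rw [mul_comm, hS1] at hy
    exact absurd hy (by decide)
  have hne : S.card ≠ 0 := by
    intro h
    apply hx0
    funext d
    by_contra hd
    have : d ∈ S := by simpa [hS] using hd
    rw [Finset.card_eq_zero] at h
    simp [h] at this
  rw [hwt]
  by_contra hlt
  have hc : S.card = 1 ∨ S.card = 2 := by omega
  rcases hc with hc | hc
  · obtain ⟨d, hd⟩ := Finset.card_eq_one.1 hc
    rw [hd, Finset.sum_singleton] at hS2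
    have := d.2.1
    rw [hS2, map_zero] at this
    exact absurd this (by decide)
  · obtain ⟨d, e, hde, hd⟩ := Finset.card_eq_two.1 hc
    rw [hd, Finset.sum_pair hde] at hS2
    exact hde (Subtype.ext (CharTwo.add_eq_zero.1 hS2))

lemma weightCount_eq (hinj : Function.Injective (codeMap m u ρ)) (w : ℕ) :
    weightCount (codeD m u ρ : Set (↥(Dset m u ρ) → ZMod 2)) w =
      Nat.card {b : GaloisField 2 m // wt (codeMap m u ρ b) = w} := by
  symm
  refine Nat.card_congr (Equiv.ofBijective
    (fun b => ⟨codeMap m u ρ b.1, ⟨b.1, rfl⟩, b.2⟩) ⟨?_, ?_⟩)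
  · intro a b hab
    exact Subtype.ext (hinj (congrArg Subtype.val hab))
  · rintro ⟨_, ⟨b, rfl⟩, hb⟩
    exact ⟨⟨b, hb⟩, rfl⟩

lemma weights (r : ℕ) (hmr : m = 2 * r + 3) (hgcd : Nat.gcd u m = 1)
    (hρ : (Even ((m ^ 2 - 1) / 8) ∧ ρ = 1) ∨ (Odd ((m ^ 2 - 1) / 8) ∧ ρ = 0)) :
    Nat.card (Dset m u ρ) = 2 * 2 ^ (2 * r) + 2 ^ r ∧
    (∀ b : GaloisField 2 m,
      wt (codeMap m u ρ b) + wt (codeMap m u ρ (b + 1)) = 2 * 2 ^ (2 * r) + 2 ^ r) ∧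
    ∀ b : GaloisField 2 m, b ≠ 0 → b ≠ 1 → wt (codeMap m u ρ b) = 2 ^ (2 * r) ∨
      wt (codeMap m u ρ b) = 2 ^ (2 * r) + 2 ^ r := by
  classical
  have hm0 : m ≠ 0 := by omega
  have hmodd : Odd m := ⟨r + 1, by omega⟩
  have hq : (2 : ℤ) ^ m = 8 * 2 ^ (2 * r) := by rw [hmr, pow_add]; ring
  have hh : (m + 1) / 2 = r + 2 := by omega
  have hh2 : (2 : ℤ) ^ ((m + 1) / 2) = 4 * 2 ^ r := by rw [hh, pow_add]; ring
  have ht1 : tr (GaloisField 2 m) 1 = 1 := tr_one m (card_GF m hm0) hmodd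
  have hn : (Nat.card (Dset m u ρ) : ℤ) = 2 * 2 ^ (2 * r) + 2 ^ r := by
    have h := Ts_formula m u ρ hm0 0
    rw [Ts_zero, if_pos rfl, if_neg zero_ne_one, zero_add, Ws_one u m hmodd hgcd,
      Ws_zero m u hmodd hgcd 0 (map_zero _), hq, hh2] at h
    have hs := sg_rho m hmodd ρ hρ
    apply mul_left_cancel₀ (show (4 : ℤ) ≠ 0 by norm_num)
    linear_combination h - 4 * 2 ^ r * hs
  refine ⟨by exact_mod_cast hn, ?_, ?_⟩
  · intro b
    have h1 := Ts_eq_wt m u ρ b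
    have h2 := Ts_eq_wt m u ρ (b + 1)
    rw [Ts_add_one m u ρ hm0, hn] at h2
    rw [hn] at h1
    zify
    linarith
  · intro b hb0 hb1
    have h1 := Ts_eq_wt m u ρ b
    have h := Ts_formula m u ρ hm0 b
    rw [if_neg hb0, if_neg hb1] at h
    have hsg : sg ρ = 1 ∨ sg ρ = -1 := by
      rcases zmod2_cases ρ with h | h <;> simp [h, sg_zero, sg_one]
    have hT : Ts m u ρ b = 2 ^ r ∨ Ts m u ρ b = - 2 ^ r := by
      rcases zmod2_cases (tr _ b) with hb | hb
      · have hb' : tr _ (b + 1) = 1 := by rw [map_add, hb, ht1]; decide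
        obtain ⟨e, he, hW⟩ := Ws_abs m u hmodd hgcd _ hb'
        rw [Ws_zero m u hmodd hgcd b hb, hW, hh2] at h
        rcases hsg with hs | hs <;> rcases he with he | he <;> rw [hs, he] at h
        · right; linarith
        · left; linarith
        · left; linarith
        · right; linarith
      · have hb' : tr _ (b + 1) = 0 := by rw [map_add, hb, ht1]; decide
        obtain ⟨e, he, hW⟩ := Ws_abs m u hmodd hgcd _ hb
        rw [Ws_zero m u hmodd hgcd _ hb', hW, hh2] at h
        rcases hsg with hs | hs <;> rcases he with he | he <;> rw [hs, he] at h
        · left; linarith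
        · right; linarith
        · right; linarith
        · left; linarith
    rw [hn] at h1
    zify
    rcases hT with hT | hT
    · left; linarith
    · right; linarith

end final

theorem codeD_three_weight_plus (m u : ℕ) (hm : 5 ≤ m) (hmodd : Odd m) (hu : 0 < u)
    (hgcd : Nat.gcd u m = 1) (ρ : ZMod 2)
    (hρ : (Even ((m ^ 2 - 1) / 8) ∧ ρ = 1) ∨ (Odd ((m ^ 2 - 1) / 8) ∧ ρ = 0)) :
    Nat.card (Dset m u ρ) = 2 ^ (m - 2) + 2 ^ ((m - 3) / 2) ∧
    Module.finrank (ZMod 2) (codeD m u ρ) = m ∧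
    IsMinDist (codeD m u ρ : Set (↥(Dset m u ρ) → ZMod 2)) (2 ^ (m - 3)) ∧
    IsProjective (codeD m u ρ : Set (↥(Dset m u ρ) → ZMod 2)) ∧
    numNonzeroWeights (codeD m u ρ : Set (↥(Dset m u ρ) → ZMod 2)) = 3 ∧
    weightCount (codeD m u ρ : Set (↥(Dset m u ρ) → ZMod 2)) (2 ^ (m - 3)) = 2 ^ (m - 1) - 1 ∧
    weightCount (codeD m u ρ : Set (↥(Dset m u ρ) → ZMod 2)) (2 ^ (m - 3) + 2 ^ ((m - 3) / 2)) = 2 ^ (m - 1) - 1 ∧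
    weightCount (codeD m u ρ : Set (↥(Dset m u ρ) → ZMod 2)) (2 ^ (m - 2) + 2 ^ ((m - 3) / 2)) = 1 ∧
    ∀ i : ℕ, 1 ≤ i → i ≠ 2 ^ (m - 3) → i ≠ 2 ^ (m - 3) + 2 ^ ((m - 3) / 2) →
      i ≠ 2 ^ (m - 2) + 2 ^ ((m - 3) / 2) → weightCount (codeD m u ρ : Set (↥(Dset m u ρ) → ZMod 2)) i = 0 := by
  classical
  obtain ⟨r, hmr⟩ : ∃ r, m = 2 * r + 3 := by
    obtain ⟨c, hc⟩ := hmodd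
    exact ⟨c - 1, by omega⟩
  obtain ⟨hn, hcomp, hw⟩ := weights m u ρ r hmr hgcd hρ
  have hm0 : m ≠ 0 := by omega
  have e1 : m - 3 = 2 * r := by omega
  have e2 : 2 ^ (m - 2) = 2 * 2 ^ (2 * r) := by
    rw [show m - 2 = 2 * r + 1 by omega, pow_succ]; ring
  have e3 : (m - 3) / 2 = r := by omega
  have e4 : 2 ^ (m - 1) = 4 * 2 ^ (2 * r) := by
    rw [show m - 1 = 2 * r + 2 by omega, pow_add]; ring
  have e5 : Nat.card (GaloisField 2 m) = 8 * 2 ^ (2 * r) := by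
    rw [GaloisField.card 2 m hm0, hmr, pow_add]; ring
  rw [e2, e3, e4, e1]
  have hP : 0 < 2 ^ (2 * r) := by positivity
  have hR : 0 < 2 ^ r := by positivity
  generalize 2 ^ (2 * r) = P at *
  generalize 2 ^ r = R at *
  have hw0 : wt (codeMap m u ρ 0) = 0 := by simp [wt]
  have hw1 : wt (codeMap m u ρ 1) = 2 * P + R := by
    have := hcomp 0
    rwa [zero_add, hw0, zero_add] at this
  have hpos : ∀ b, b ≠ 0 → P ≤ wt (codeMap m u ρ b) := by
    intro b hb
    by_cases hb1 : b = 1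
    · rw [hb1, hw1]; omega
    · rcases hw b hb hb1 with h | h <;> omega
  have hinj : Function.Injective (codeMap m u ρ) := by
    rw [injective_iff_map_eq_zero]
    intro b hb
    by_contra h
    have := hpos b h
    rw [hb, ← map_zero (codeMap m u ρ), hw0] at this
    omega
  have hfr : Module.finrank (ZMod 2) (codeD m u ρ) = m := by
    rw [codeD, LinearMap.finrank_range_of_inj hinj, GaloisField.finrank 2 hm0]
  have hWC := weightCount_eq m u ρ hinj
  have hn1 : weightCount (codeD m u ρ : Set (↥(Dset m u ρ) → ZMod 2)) (2 * P + R) = 1 := by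
    rw [hWC, Nat.card_eq_one_iff_unique]
    refine ⟨⟨?_⟩, ⟨⟨1, hw1⟩⟩⟩
    have key : ∀ b, wt (codeMap m u ρ b) = 2 * P + R → b = 1 := by
      intro b hb
      by_contra hb1
      by_cases hb0 : b = 0
      · rw [hb0, hw0] at hb; omega
      · rcases hw b hb0 hb1 with h | h <;> omega
    rintro ⟨a, ha⟩ ⟨b, hb⟩
    exact Subtype.ext ((key a ha).trans (key b hb).symm)
  have hzero : ∀ i : ℕ, 1 ≤ i → i ≠ P → i ≠ P + R → i ≠ 2 * P + R →
      weightCount (codeD m u ρ : Set (↥(Dset m u ρ) → ZMod 2)) i = 0 := by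
    intro i hi h1 h2 h3
    rw [hWC]
    have : IsEmpty {b : GaloisField 2 m // wt (codeMap m u ρ b) = i} := by
      refine ⟨?_⟩
      rintro ⟨b, hb⟩
      by_cases hb0 : b = 0
      · rw [hb0, hw0] at hb; omega
      by_cases hb1 : b = 1
      · rw [hb1, hw1] at hb; omega
      rcases hw b hb0 hb1 with h | h <;> omega
    exact Nat.card_of_isEmpty
  have heq : Nat.card {b : GaloisField 2 m // wt (codeMap m u ρ b) = P} =
      Nat.card {b : GaloisField 2 m // wt (codeMap m u ρ b) = P + R} := by
    refine Nat.card_congr (Equiv.subtypeEquiv (Equiv.addRight 1) fun b => ?_)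
    have := hcomp b
    simp only [Equiv.coe_addRight]
    omega
  have hsum : Nat.card {b : GaloisField 2 m // wt (codeMap m u ρ b) = P} +
      Nat.card {b : GaloisField 2 m // wt (codeMap m u ρ b) = P + R} + 2 = 8 * P := by
    rw [← e5]
    simp only [Nat.card_eq_fintype_card, Fintype.card_subtype]
    have h01 : (0 : GaloisField 2 m) ≠ 1 := zero_ne_one
    have h2 := Finset.card_pair h01
    apply (congrArg (_ + ·) h2.symm).trans
    rw [← Finset.card_univ, ← Finset.card_union_of_disjoint,
      ← Finset.card_union_of_disjoint]
    · congr 1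
      ext b
      simp only [Finset.mem_union, Finset.mem_filter, Finset.mem_univ, true_and,
        Finset.mem_insert, Finset.mem_singleton, iff_true]
      have := hw b
      tauto
    · rw [Finset.disjoint_right]
      intro b hb
      simp only [Finset.mem_union, Finset.mem_filter, Finset.mem_univ, true_and,
        Finset.mem_insert, Finset.mem_singleton] at hb ⊢
      rcases hb with rfl | rfl
      · rw [hw0]; omega
      · rw [hw1]; omega
    · rw [Finset.disjoint_right]
      intro b hb
      simp only [Finset.mem_filter, Finset.mem_univ, true_and] at hb ⊢
      omega
  have hA : weightCount (codeD m u ρ : Set (↥(Dset m u ρ) → ZMod 2)) P = 4 * P - 1 := by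
    rw [hWC]; omega
  have hB : weightCount (codeD m u ρ : Set (↥(Dset m u ρ) → ZMod 2)) (P + R) = 4 * P - 1 := by
    rw [hWC]; omega
  refine ⟨hn, hfr, ⟨?_, ?_⟩, codeD_projective m u ρ, ?_, hA, hB, hn1, hzero⟩
  · have hpos' : 0 < Nat.card {b : GaloisField 2 m // wt (codeMap m u ρ b) = P} := by omega
    obtain ⟨⟨b, hb⟩⟩ := (Nat.card_pos_iff.1 hpos').1
    refine ⟨codeMap m u ρ b, ⟨b, rfl⟩, ?_, hb⟩
    intro h
    rw [h, ← map_zero (codeMap m u ρ), hw0] at hb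
    omega
  · rintro _ ⟨b, rfl⟩ hb
    apply hpos
    rintro rfl
    exact hb (map_zero _)
  · rw [numNonzeroWeights]
    have : {i : ℕ | 1 ≤ i ∧ weightCount (codeD m u ρ : Set (↥(Dset m u ρ) → ZMod 2)) i ≠ 0} =
        (({P, P + R, 2 * P + R} : Finset ℕ) : Set ℕ) := by
      ext i
      simp only [Set.mem_ofPred_eq, Finset.coe_insert, Finset.coe_singleton, Set.mem_insert_iff,
        Set.mem_singleton_iff]
      constructor
      · rintro ⟨hi, h⟩
        by_contra hcon
        push Not at hcon
        exact h (hzero i hi hcon.1 hcon.2.1 hcon.2.2)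
      · rintro (rfl | rfl | rfl)
        · exact ⟨hP, by omega⟩
        · exact ⟨by omega, by omega⟩
        · exact ⟨by omega, by omega⟩
    rw [this, Nat.card_coe_set_eq, Set.ncard_coe_finset]
    rw [Finset.card_eq_three]
    exact ⟨P, P + R, 2 * P + R, by omega, by omega, by omega, rfl⟩
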